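/- Fix N ≥ 2 and let F : ℝ^{N−1} → ℝ be smooth with compact support. Define BF(y) := Σ_{k=1}^{N−1} ( ∂F/∂y_{k−1}(y) + ∂F/∂y_{k+1}(y) − 2·∂F/∂y_k(y) )·y_k, with the conventions ∂F/∂y_0 := 0 and ∂F/∂y_N := 0 and Δ^r_{n,0}F = Δ^r_{n,N}F = 0. Then sup over y ∈ (n^{−1/2}ℕ)^{N−1} of | BF(y) − Σ_{k=1}^{N−1} ( Δ^r_{n,k−1}F(y − e_k/√n) + Δ^r_{n,k+1}F(y − e_k/√n) − 2Δ^l_{n,k}F(y) )·y_k | tends to 0 as n → ∞. -/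

import Mathlib

open Filter

theorem key_est {E : Type*} [NormedAddCommGroup E] [NormedSpace ℝ E] (F : E → ℝ)
    (hF : ContDiff ℝ (⊤ : ℕ∞) F) (hs : HasCompactSupport F) (δ : ℝ) (hδ : 0 < δ) :
    ∃ η : ℝ, 0 < η ∧ ∀ h : ℝ, 0 < h → h ≤ η → ∀ x y u : E, ‖u‖ ≤ 1 → ‖x - y‖ ≤ h →
      |fderiv ℝ F y u - h⁻¹ * (F (x + h • u) - F x)| * ‖y‖ ≤ δ := by
  obtain ⟨R, hR⟩ := hs.isCompact.isBounded.subset_closedBall (0 : E)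
  have hz : ∀ z : E, |R| < ‖z‖ → z ∉ tsupport F := by
    intro z hz hm
    have := hR hm
    rw [mem_closedBall_zero_iff] at this
    have := le_abs_self R
    linarith
  have hc : Continuous (fderiv ℝ F) := hF.continuous_fderiv (by simp)
  have huc : UniformContinuous (fderiv ℝ F) :=
    (hs.fderiv (𝕜 := ℝ)).uniformContinuous_of_continuous hc
  have hRp : 0 < |R| + 2 := by positivity
  obtain ⟨r, hr, hur⟩ := Metric.uniformContinuous_iff.1 huc (δ / (|R| + 2)) (by positivity)
  refine ⟨min 1 (r / 3), by positivity, ?_⟩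
  intro h h0 hh x y u hu hxy
  have h1 : h ≤ 1 := hh.trans (min_le_left _ _)
  have h2 : h ≤ r / 3 := hh.trans (min_le_right _ _)
  have hhu : ‖h • u‖ ≤ h := by
    rw [norm_smul, Real.norm_of_nonneg h0.le]
    nlinarith
  have hxu : ‖x + h • u - y‖ ≤ 2 * h := by
    have : x + h • u - y = (x - y) + h • u := by abel
    rw [this]
    exact (norm_add_le _ _).trans (by linarith)
  by_cases hy : ‖y‖ ≤ |R| + 2
  · have hmv : ‖F (x + h • u) - F x - fderiv ℝ F y (x + h • u - x)‖
        ≤ δ / (|R| + 2) * ‖x + h • u - x‖ := by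
      refine (convex_ball y r).norm_image_sub_le_of_norm_fderiv_le' (𝕜 := ℝ) (f := F)
        (fun z _ => (hF.differentiable (by simp)) z) ?_ ?_ ?_
      · intro z hz
        rw [← dist_eq_norm]
        exact (hur hz).le
      · rw [mem_ball_iff_norm]; linarith
      · rw [mem_ball_iff_norm]; linarith
    rw [add_sub_cancel_left, map_smul, smul_eq_mul, Real.norm_eq_abs] at hmv
    have e : fderiv ℝ F y u - h⁻¹ * (F (x + h • u) - F x)
        = - (h⁻¹ * (F (x + h • u) - F x - h * fderiv ℝ F y u)) := by
      field_simp; ring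
    have hb : |fderiv ℝ F y u - h⁻¹ * (F (x + h • u) - F x)| ≤ δ / (|R| + 2) := by
      rw [e, abs_neg, abs_mul, abs_of_pos (inv_pos.2 h0), inv_mul_le_iff₀ h0, mul_comm h (δ / (|R| + 2))]
      exact hmv.trans (mul_le_mul_of_nonneg_left hhu (by positivity))
    calc _ ≤ δ / (|R| + 2) * (|R| + 2) := by gcongr
      _ = δ := by field_simp
  · push Not at hy
    have a1 : ‖y‖ - ‖x‖ ≤ ‖x - y‖ := by rw [norm_sub_rev]; exact norm_sub_norm_le _ _
    have a2 : ‖y‖ - ‖x + h • u‖ ≤ ‖x + h • u - y‖ := by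
      rw [norm_sub_rev]; exact norm_sub_norm_le _ _
    have b1 : fderiv ℝ F y = 0 := by
      by_contra hne
      exact hz y (by linarith) (support_fderiv_subset ℝ hne)
    have b2 : F x = 0 := image_eq_zero_of_notMem_tsupport (hz x (by linarith))
    have b3 : F (x + h • u) = 0 := by
      by_cases hq : |R| < ‖x + h • u‖
      · exact image_eq_zero_of_notMem_tsupport (hz _ hq)
      · exfalso; linarith
    rw [b1, b2, b3]
    simp [hδ.le]

/-- Scaled right difference `Δʳ_{n,k}F(y) = √n·(F(y + e_k/√n) − F(y))` for
`k ∈ {1,…,m}` (coordinate `k` of the book is coordinate `k−1` of `Fin m`);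
by convention it is `0` for `k = 0` or `k > m`. -/
noncomputable def dR (m n : ℕ) (F : (Fin m → ℝ) → ℝ) (k : ℕ) (y : Fin m → ℝ) : ℝ :=
  if h : 1 ≤ k ∧ k ≤ m then
    Real.sqrt n *
      (F (y + (Real.sqrt n)⁻¹ • (Pi.single (⟨k - 1, by omega⟩ : Fin m) (1:ℝ) : Fin m → ℝ)) - F y)
  else 0

/-- Scaled left difference `Δˡ_{n,k}F(y) = √n·(F(y) − F(y − e_k/√n))`. -/
noncomputable def dL (m n : ℕ) (F : (Fin m → ℝ) → ℝ) (k : ℕ) (y : Fin m → ℝ) : ℝ :=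
  if h : 1 ≤ k ∧ k ≤ m then
    Real.sqrt n *
      (F y - F (y - (Real.sqrt n)⁻¹ • (Pi.single (⟨k - 1, by omega⟩ : Fin m) (1:ℝ) : Fin m → ℝ)))
  else 0

/-- The `k`-th coordinate `y_k` of `y`, with the conventions `y_0 = y_{m+1} = 0`. -/
def coordv (m : ℕ) (y : Fin m → ℝ) (k : ℕ) : ℝ :=
  if h : 1 ≤ k ∧ k ≤ m then y ⟨k - 1, by omega⟩ else 0

/-- The partial derivative `∂F/∂y_k`, with the conventions `∂F/∂y_0 = ∂F/∂y_{m+1} = 0`. -/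
noncomputable def pd1 (m : ℕ) (F : (Fin m → ℝ) → ℝ) (k : ℕ) (y : Fin m → ℝ) : ℝ :=
  if h : 1 ≤ k ∧ k ≤ m then
    fderiv ℝ F y (Pi.single (⟨k - 1, by omega⟩ : Fin m) (1:ℝ) : Fin m → ℝ)
  else 0

/-- The shifted point `y − e_k/√n` (equal to `y` if `k` is out of range). -/
noncomputable def shiftDown (m n k : ℕ) (y : Fin m → ℝ) : Fin m → ℝ :=
  if h : 1 ≤ k ∧ k ≤ m then
    y - (Real.sqrt n)⁻¹ • (Pi.single (⟨k - 1, by omega⟩ : Fin m) (1:ℝ) : Fin m → ℝ)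
  else y

/-- Uniform convergence, on the lattice `(n^{-1/2}ℕ)^{N−1}`,
of the order-repositioning (random walk) part of the rescaled generator to
`BF(y) = Σ_{k=1}^{N−1} (∂F/∂y_{k−1} + ∂F/∂y_{k+1} − 2∂F/∂y_k)·y_k`, with the
conventions `∂F/∂y_0 = ∂F/∂y_N = 0` and `Δʳ_{n,0}F = Δʳ_{n,N}F = 0`. -/
theorem stmt9 (N : ℕ) (hN : 2 ≤ N)
    (F : (Fin (N - 1) → ℝ) → ℝ)
    (hF_smooth : ContDiff ℝ (⊤ : ℕ∞) F) (hF_supp : HasCompactSupport F) :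
    ∀ ε : ℝ, 0 < ε → ∀ᶠ n : ℕ in atTop,
      ∀ y : Fin (N - 1) → ℝ, (∀ i, ∃ m : ℕ, y i = (m : ℝ) / Real.sqrt n) →
        |(∑ k ∈ Finset.Icc 1 (N - 1),
            (pd1 (N - 1) F (k - 1) y + pd1 (N - 1) F (k + 1) y - 2 * pd1 (N - 1) F k y) *
              coordv (N - 1) y k) -
          (∑ k ∈ Finset.Icc 1 (N - 1),
            (dR (N - 1) n F (k - 1) (shiftDown (N - 1) n k y)
              + dR (N - 1) n F (k + 1) (shiftDown (N - 1) n k y)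
              - 2 * dL (N - 1) n F k y) * coordv (N - 1) y k)| ≤ ε := by
  intro ε hε
  have hNpos : (0 : ℝ) < N := by positivity
  obtain ⟨η, hη, hkey⟩ := key_est F hF_smooth hF_supp (ε / (4 * N)) (by positivity)
  have ht : Tendsto (fun n : ℕ => (Real.sqrt n)⁻¹) atTop (nhds 0) :=
    tendsto_inv_atTop_zero.comp (Real.tendsto_sqrt_atTop.comp tendsto_natCast_atTop_atTop)
  filter_upwards [ht.eventually (ge_mem_nhds hη), eventually_gt_atTop 0] with n hn hn0 y _
  have hsq : 0 < Real.sqrt n := Real.sqrt_pos.2 (by exact_mod_cast hn0)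
  have hh : 0 < (Real.sqrt n)⁻¹ := inv_pos.2 hsq
  have hunit : ∀ i : Fin (N - 1), ‖(Pi.single i (1 : ℝ) : Fin (N - 1) → ℝ)‖ ≤ 1 := by
    intro i; rw [Pi.norm_single]; simp
  have hsd : ∀ k, ‖shiftDown (N - 1) n k y - y‖ ≤ (Real.sqrt n)⁻¹ := by
    intro k
    unfold shiftDown
    split_ifs with h
    · rw [sub_sub_cancel_left, norm_neg, norm_smul, Real.norm_of_nonneg hh.le]
      exact mul_le_of_le_one_right hh.le (hunit _)
    · simpa using hh.le
  have hδ0 : 0 ≤ ε / (4 * N) := by positivity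
  have hR : ∀ j k, |pd1 (N - 1) F j y - dR (N - 1) n F j (shiftDown (N - 1) n k y)| * ‖y‖
      ≤ ε / (4 * N) := by
    intro j k
    unfold pd1 dR
    split_ifs with h
    · have := hkey _ hh hn (shiftDown (N - 1) n k y) y _ (hunit ⟨j - 1, by omega⟩) (hsd k)
      rwa [inv_inv] at this
    · simpa using hδ0
  have hL : ∀ k, |pd1 (N - 1) F k y - dL (N - 1) n F k y| * ‖y‖ ≤ ε / (4 * N) := by
    intro k
    by_cases h : 1 ≤ k ∧ k ≤ N - 1
    · have := hkey _ hh hn (shiftDown (N - 1) n k y) y _ (hunit ⟨k - 1, by omega⟩) (hsd k)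
      simp only [pd1, dL, dif_pos h]
      simpa only [inv_inv, shiftDown, dif_pos h, sub_add_cancel] using this
    · simpa [pd1, dL, dif_neg h] using hδ0
  have hco : ∀ k, |coordv (N - 1) y k| ≤ ‖y‖ := by
    intro k
    unfold coordv
    split_ifs with h
    · exact norm_le_pi_norm y _
    · simp
  rw [← Finset.sum_sub_distrib]
  refine (Finset.abs_sum_le_sum_abs _ _).trans ?_
  have hterm : ∀ k ∈ Finset.Icc 1 (N - 1),
      |(pd1 (N - 1) F (k - 1) y + pd1 (N - 1) F (k + 1) y - 2 * pd1 (N - 1) F k y) *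
              coordv (N - 1) y k - (dR (N - 1) n F (k - 1) (shiftDown (N - 1) n k y)
              + dR (N - 1) n F (k + 1) (shiftDown (N - 1) n k y)
              - 2 * dL (N - 1) n F k y) * coordv (N - 1) y k| ≤ ε / N := by
    intro k _
    have h1 := hR (k - 1) k
    have h2 := hR (k + 1) k
    have h3 := hL k
    rw [← sub_mul, abs_mul]
    generalize pd1 (N - 1) F (k - 1) y = a1 at *
    generalize pd1 (N - 1) F (k + 1) y = a2 at *
    generalize pd1 (N - 1) F k y = a3 at *
    generalize dR (N - 1) n F (k - 1) (shiftDown (N - 1) n k y) = b1 at *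
    generalize dR (N - 1) n F (k + 1) (shiftDown (N - 1) n k y) = b2 at *
    generalize dL (N - 1) n F k y = b3 at *
    have e : a1 + a2 - 2 * a3 - (b1 + b2 - 2 * b3)
        = (a1 - b1) + (a2 - b2) - 2 * (a3 - b3) := by ring
    have hab : |a1 + a2 - 2 * a3 - (b1 + b2 - 2 * b3)|
        ≤ |a1 - b1| + |a2 - b2| + 2 * |a3 - b3| := by
      rw [e]
      refine (abs_sub _ _).trans ?_
      rw [abs_mul, abs_two]
      have := abs_add_le (a1 - b1) (a2 - b2)
      linarith
    calc _ ≤ (|a1 - b1| + |a2 - b2| + 2 * |a3 - b3|) * ‖y‖ :=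
          mul_le_mul hab (hco k) (abs_nonneg _) (by positivity)
      _ = |a1 - b1| * ‖y‖ + |a2 - b2| * ‖y‖ + 2 * (|a3 - b3| * ‖y‖) := by ring
      _ ≤ ε / (4 * N) + ε / (4 * N) + 2 * (ε / (4 * N)) := by linarith
      _ = ε / N := by field_simp; ring
  refine (Finset.sum_le_card_nsmul _ _ _ hterm).trans ?_
  rw [Nat.card_Icc, nsmul_eq_mul]
  have hle : ((N - 1 + 1 - 1 : ℕ) : ℝ) ≤ N := by
    exact_mod_cast (by omega : N - 1 + 1 - 1 ≤ N)
  calc _ ≤ (N : ℝ) * (ε / N) := by gcongr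
    _ = ε := by field_simp
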